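/- arXiv:1107.1529 — 6 statements merged into one kernel-verified Lean document; each statement's English description precedes it below -/
import Mathlib

section
/- Let F be a field, let m, s, l be positive integers with s ≤ l, and let d_1, …, d_s be positive integers with d_i ≥ i·d_1 for every i = 2, …, s. Let e_1, …, e_l ∈ F^m be vectors whose total Hamming weight satisfies Σ_{j=1}^l wt(e_j) ≤ ⌊(l·d_1 − 1)/2⌋. Then for every i ∈ {1, …, s} there exists a subset J ⊆ {1, …, l} with |J| = i such that 2·Σ_{j∈J} wt(e_j) < d_i. -/
/-- Averaging: among the `i`-element subsets of `S`, some one has a mean weight which is at most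
the mean weight of `S`. -/
theorem Finset.exists_subset_card_eq_card_nsmul_sum_le {ι M : Type*} [AddCommMonoid M]
    [LinearOrder M] [IsOrderedAddMonoid M] (w : ι → M) (S : Finset ι) :
    ∀ i ≤ S.card, ∃ J ⊆ S, J.card = i ∧ S.card • ∑ j ∈ J, w j ≤ i • ∑ j ∈ S, w j := by
  classical
  induction S using Finset.induction_on_max_value w with
  | empty => intro i hi; exact ⟨∅, by simp_all⟩
  | insert a S ha hmax ih =>
    intro i hi
    rcases hi.eq_or_lt with rfl | hlt
    · exact ⟨insert a S, subset_rfl, rfl, le_rfl⟩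
    · rw [Finset.card_insert_of_notMem ha] at hlt
      obtain ⟨J, hJS, rfl, hJ⟩ := ih i (Nat.lt_succ_iff.mp hlt)
      refine ⟨J, hJS.trans (Finset.subset_insert a S), rfl, ?_⟩
      rw [Finset.card_insert_of_notMem ha, Finset.sum_insert ha, succ_nsmul, nsmul_add,
        add_comm (J.card • w a)]
      exact add_le_add hJ (Finset.sum_le_card_nsmul J w (w a) fun x hx => hmax x (hJS hx))

/-- Theorem 1 (th:goodd): if the total Hamming weight of the error blocks is at most
`⌊(l * d 1 - 1) / 2⌋`, then for every `i ∈ {1, …, s}` there is a set `J` of `i`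
column positions whose accumulated error weight is less than `d i / 2`. -/
theorem stmt1 {F : Type*} [Field F] [DecidableEq F] (m s l : ℕ)
    (hm : 0 < m) (hs : 0 < s) (hl : 0 < l) (hsl : s ≤ l)
    (d : ℕ → ℕ) (hdpos : ∀ i, 1 ≤ i → i ≤ s → 0 < d i)
    (hd : ∀ i, 2 ≤ i → i ≤ s → i * d 1 ≤ d i)
    (e : Fin l → (Fin m → F))
    (he : ∑ j, hammingNorm (e j) ≤ (l * d 1 - 1) / 2) :
    ∀ i, 1 ≤ i → i ≤ s →
      ∃ J : Finset (Fin l), J.card = i ∧ 2 * ∑ j ∈ J, hammingNorm (e j) < d i := by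
  intro i hi his
  obtain ⟨J, -, hJ, hle⟩ := Finset.exists_subset_card_eq_card_nsmul_sum_le
    (fun j => hammingNorm (e j)) Finset.univ i (by simpa using his.trans hsl)
  refine ⟨J, hJ, ?_⟩
  simp only [Finset.card_univ, Fintype.card_fin, smul_eq_mul] at hle
  have hdi : i * d 1 ≤ d i := by
    rcases hi.eq_or_lt with rfl | h
    · simp
    · exact hd i h his
  have htot : 2 * ∑ j, hammingNorm (e j) < l * d 1 := by
    have := Nat.mul_pos hl (hdpos 1 le_rfl hs)
    omega
  refine lt_of_lt_of_le (lt_of_mul_lt_mul_left ?_ (Nat.zero_le l)) hdi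
  calc l * (2 * ∑ j ∈ J, hammingNorm (e j)) = 2 * (l * ∑ j ∈ J, hammingNorm (e j)) := by ring
    _ ≤ 2 * (i * ∑ j, hammingNorm (e j)) := Nat.mul_le_mul_left 2 hle
    _ = i * (2 * ∑ j, hammingNorm (e j)) := by ring
    _ < i * (l * d 1) := Nat.mul_lt_mul_of_pos_left htot hi
    _ = l * (i * d 1) := by ring
end

section
/- Let F be a field, let m, s, l be positive integers with s ≤ l and l even, let t_1 ≥ 1 be an integer and set d_1 = 2·t_1 + 1, and let d_2, …, d_s be positive integers with d_i > i·d_1 for every i = 2, …, s. Let e_1, …, e_l ∈ F^m be vectors whose total Hamming weight satisfies Σ_{j=1}^l wt(e_j) ≤ l·t_1 + l/2. Then for every i ∈ {1, …, s} there exists a subset J ⊆ {1, …, l} with |J| = i such that 2·Σ_{j∈J} wt(e_j) < d_i. -/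
/-- Among the subsets of `s` of a given size, some subset has average value at most that
of `s`. -/
theorem Finset.exists_subset_card_eq_card_mul_sum_le {ι : Type*} (s : Finset ι) (f : ι → ℕ)
    {i : ℕ} (hi : i ≤ s.card) :
    ∃ J ⊆ s, J.card = i ∧ s.card * ∑ j ∈ J, f j ≤ i * ∑ j ∈ s, f j := by
  classical
  induction hi using Nat.decreasingInduction with
  | self => exact ⟨s, subset_rfl, rfl, le_rfl⟩
  | of_succ k _ ih =>
    obtain ⟨J, hJs, hJ, hsum⟩ := ih
    have hne : J.Nonempty := Finset.card_pos.mp (by omega)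
    obtain ⟨a, ha, hmax⟩ := J.exists_max_image f hne
    refine ⟨J.erase a, (J.erase_subset a).trans hJs, by simp [ha, hJ], ?_⟩
    have hle : ∑ j ∈ J, f j ≤ (k + 1) * f a := by
      simpa [hJ] using J.sum_le_card_nsmul f (f a) hmax
    have herase := J.sum_erase_add f ha
    have hk : (k + 1) * ∑ j ∈ J.erase a, f j ≤ k * ∑ j ∈ J, f j := by
      rw [← herase] at hle ⊢
      linarith
    refine Nat.le_of_mul_le_mul_left ?_ k.succ_pos
    calc (k + 1) * (s.card * ∑ j ∈ J.erase a, f j)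
        = s.card * ((k + 1) * ∑ j ∈ J.erase a, f j) := by ring
      _ ≤ s.card * (k * ∑ j ∈ J, f j) := by gcongr
      _ = k * (s.card * ∑ j ∈ J, f j) := by ring
      _ ≤ k * ((k + 1) * ∑ j ∈ s, f j) := by gcongr
      _ = (k + 1) * (k * ∑ j ∈ s, f j) := by ring


/-- Theorem 2 (th:goodd2): with `d 1 = 2 * t₁ + 1` odd, `l` even, `d i > i * d 1` and
total error weight at most `l * t₁ + l / 2`, for every `i ∈ {1, …, s}` there is a set
`J` of `i` column positions whose accumulated error weight is less than `d i / 2`. -/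
theorem stmt2 {F : Type*} [Field F] [DecidableEq F] (m s l : ℕ)
    (hm : 0 < m) (hs : 0 < s) (hl : 0 < l) (hsl : s ≤ l) (hleven : Even l)
    (t₁ : ℕ) (ht₁ : 1 ≤ t₁)
    (d : ℕ → ℕ) (hd1 : d 1 = 2 * t₁ + 1)
    (hdpos : ∀ i, 2 ≤ i → i ≤ s → 0 < d i)
    (hd : ∀ i, 2 ≤ i → i ≤ s → i * d 1 < d i)
    (e : Fin l → (Fin m → F))
    (he : ∑ j, hammingNorm (e j) ≤ l * t₁ + l / 2) :
    ∀ i, 1 ≤ i → i ≤ s →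
      ∃ J : Finset (Fin l), J.card = i ∧ 2 * ∑ j ∈ J, hammingNorm (e j) < d i := by
  intro i hi1 his
  obtain ⟨J, -, hJ, hsum⟩ := Finset.univ.exists_subset_card_eq_card_mul_sum_le
    (fun j => hammingNorm (e j)) (i := i) (by simpa using his.trans hsl)
  rw [Finset.card_fin] at hsum
  have hle : 2 * ∑ j ∈ J, hammingNorm (e j) ≤ i * (2 * t₁ + 1) := by
    refine Nat.le_of_mul_le_mul_left ?_ hl
    calc l * (2 * ∑ j ∈ J, hammingNorm (e j))
        = 2 * (l * ∑ j ∈ J, hammingNorm (e j)) := by ring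
      _ ≤ 2 * (i * (l * t₁ + l / 2)) := by
        exact Nat.mul_le_mul_left 2 (hsum.trans (Nat.mul_le_mul_left i he))
      _ = i * (2 * (l * t₁) + 2 * (l / 2)) := by ring
      _ = l * (i * (2 * t₁ + 1)) := by
        rw [Nat.two_mul_div_two_of_even hleven]
        ring
  refine ⟨J, hJ, ?_⟩
  obtain rfl | hi2 := hi1.eq_or_lt
  · omega
  · exact hle.trans_lt (hd1 ▸ hd i hi2 his)
end

section
/- Let F be a field, m a positive integer, d_1 and d_2 positive integers with d_2 ≥ 2·d_1, and let C_2 ⊆ F^m be a linear code in which every nonzero codeword has Hamming weight at least d_2. Let c_1 ∈ F^m, c_2 ∈ C_2, and e_1, e_2 ∈ F^m with wt(e_1) + wt(e_2) ≤ ⌊(2·d_1 − 1)/2⌋. Set r_1 = c_1 + e_1 and r_2 = c_1 + c_2 + e_2. Then 2·d(r_2 − r_1, c_2) < d_2, and c_2 is the unique codeword c ∈ C_2 satisfying 2·d(r_2 − r_1, c) < d_2. -/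
/-- Correctness of the first step of the decoding algorithm for the
`(u | u+v)`-construction: the difference `r₂ - r₁` of the received blocks decodes
uniquely to `c₂` whenever `wt e₁ + wt e₂ ≤ ⌊(2 d₁ - 1) / 2⌋` and `d₂ ≥ 2 d₁`. -/
theorem stmt6 {F : Type*} [Field F] [DecidableEq F] (m : ℕ) (hm : 0 < m)
    (d₁ d₂ : ℕ) (hd₁ : 0 < d₁) (hd₂ : 0 < d₂) (h : 2 * d₁ ≤ d₂)
    (C₂ : Submodule F (Fin m → F))
    (hC₂ : ∀ c ∈ C₂, c ≠ 0 → d₂ ≤ hammingNorm c)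
    (c₁ : Fin m → F) (c₂ : Fin m → F) (hc₂ : c₂ ∈ C₂)
    (e₁ e₂ : Fin m → F) (he : hammingNorm e₁ + hammingNorm e₂ ≤ (2 * d₁ - 1) / 2)
    (r₁ r₂ : Fin m → F) (hr₁ : r₁ = c₁ + e₁) (hr₂ : r₂ = c₁ + c₂ + e₂) :
    2 * hammingDist (r₂ - r₁) c₂ < d₂ ∧
      ∀ c ∈ C₂, 2 * hammingDist (r₂ - r₁) c < d₂ → c = c₂ := by
  have hdist : hammingDist (r₂ - r₁) c₂ = hammingDist e₂ e₁ := by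
    simp only [hammingDist, hr₁, hr₂]
    congr 1
    ext i
    simp only [Finset.mem_filter, Finset.mem_univ, true_and, Pi.sub_apply, Pi.add_apply]
    rw [← sub_ne_zero, ← sub_ne_zero (a := e₂ i)]
    ring_nf
  have hle : hammingDist e₂ e₁ ≤ hammingNorm e₂ + hammingNorm e₁ := by
    simpa using hammingDist_triangle e₂ 0 e₁
  have hlt : 2 * hammingDist (r₂ - r₁) c₂ < d₂ := by omega
  refine ⟨hlt, fun c hc hclt => ?_⟩
  by_contra hne
  have hmin : d₂ ≤ hammingDist c c₂ := by
    have hsub := hC₂ (c - c₂) (C₂.sub_mem hc hc₂) (sub_ne_zero.mpr hne)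
    simpa [hammingDist, hammingNorm, sub_ne_zero] using hsub
  have htri := hammingDist_triangle_left c c₂ (r₂ - r₁)
  omega
end

section
/- Let F be a field, m a positive integer, t_1 ≥ 1 an integer, d_1 = 2·t_1 + 1, and d_2 a positive integer with d_2 > 2·d_1. Let C_2 ⊆ F^m be a linear code in which every nonzero codeword has Hamming weight at least d_2. Let c_1 ∈ F^m, c_2 ∈ C_2, and e_1, e_2 ∈ F^m with wt(e_1) + wt(e_2) ≤ 2·t_1 + 1. Set r_1 = c_1 + e_1 and r_2 = c_1 + c_2 + e_2. Then 2·d(r_2 − r_1, c_2) < d_2, and c_2 is the unique codeword c ∈ C_2 satisfying 2·d(r_2 − r_1, c) < d_2. -/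
/-- Correctness of the recovery of `c₂` in the `(u | u+v)`-construction when decoding
one error beyond the error-correction capability `t = 2 t₁` (with `d₁ = 2 t₁ + 1` odd
and `d₂ > 2 d₁`). -/
theorem stmt7 {F : Type*} [Field F] [DecidableEq F] (m : ℕ) (hm : 0 < m)
    (t₁ : ℕ) (ht₁ : 1 ≤ t₁) (d₁ : ℕ) (hd₁ : d₁ = 2 * t₁ + 1)
    (d₂ : ℕ) (hd₂ : 0 < d₂) (h : 2 * d₁ < d₂)
    (C₂ : Submodule F (Fin m → F))
    (hC₂ : ∀ c ∈ C₂, c ≠ 0 → d₂ ≤ hammingNorm c)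
    (c₁ : Fin m → F) (c₂ : Fin m → F) (hc₂ : c₂ ∈ C₂)
    (e₁ e₂ : Fin m → F) (he : hammingNorm e₁ + hammingNorm e₂ ≤ 2 * t₁ + 1)
    (r₁ r₂ : Fin m → F) (hr₁ : r₁ = c₁ + e₁) (hr₂ : r₂ = c₁ + c₂ + e₂) :
    2 * hammingDist (r₂ - r₁) c₂ < d₂ ∧
      ∀ c ∈ C₂, 2 * hammingDist (r₂ - r₁) c < d₂ → c = c₂ := by
  have hdist : hammingDist (r₂ - r₁) c₂ = hammingDist e₂ e₁ := by
    simp only [hammingDist, hr₁, hr₂, Pi.sub_apply, Pi.add_apply]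
    congr 1
    ext i
    have hi : c₁ i + c₂ i + e₂ i - (c₁ i + e₁ i) - c₂ i = e₂ i - e₁ i := by ring
    rw [Finset.mem_filter_univ, Finset.mem_filter_univ, ← sub_ne_zero, hi, sub_ne_zero]
  have hlt : 2 * hammingDist (r₂ - r₁) c₂ < d₂ := by
    have htri := hammingDist_triangle e₂ 0 e₁
    rw [hammingDist_zero_right, hammingDist_zero_left] at htri
    omega
  refine ⟨hlt, fun c hc hclt => ?_⟩
  by_contra hne
  have hmin := hC₂ (c - c₂) (C₂.sub_mem hc hc₂) (sub_ne_zero.mpr hne)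
  have hnorm : hammingNorm (c - c₂) = hammingDist c c₂ := by
    simp only [hammingNorm, hammingDist, Pi.sub_apply, sub_ne_zero]
  have htri := hammingDist_triangle_left c c₂ (r₂ - r₁)
  omega
end

section
/- Let F be a field, m, s, l positive integers with s ≤ l, A an s×l matrix over F and B an l×s matrix over F with A·B equal to the s×s identity matrix. Let c_1, …, c_s ∈ F^m and e_1, …, e_l ∈ F^m, and set r_k = Σ_{j=1}^s A_{j,k}·c_j + e_k for k = 1, …, l. Fix i ∈ {1, …, s} and let v_k = B_{k,i} be the entries of the i-th column of B. Then d(Σ_{k=1}^l v_k·r_k, c_i) ≤ Σ_{k=1}^l wt(e_k). Consequently, if C_i ⊆ F^m is a linear code with c_i ∈ C_i in which every nonzero codeword has Hamming weight at least d_i, and 2·Σ_{k=1}^l wt(e_k) < d_i, then c_i is the unique codeword c ∈ C_i satisfying 2·d(Σ_{k=1}^l v_k·r_k, c) < d_i. -/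
theorem hammingNorm_add_le {ι : Type*} {β : ι → Type*} [Fintype ι] [∀ i, DecidableEq (β i)]
    [∀ i, AddGroup (β i)] (x y : ∀ i, β i) :
    hammingNorm (x + y) ≤ hammingNorm x + hammingNorm y := by
  simpa [hammingDist_eq_hammingNorm] using hammingDist_triangle 0 x (x + y)

theorem hammingNorm_sum_le {ι κ : Type*} {β : ι → Type*} [Fintype ι] [∀ i, DecidableEq (β i)]
    [∀ i, AddCommGroup (β i)] (t : Finset κ) (f : κ → ∀ i, β i) :
    hammingNorm (∑ k ∈ t, f k) ≤ ∑ k ∈ t, hammingNorm (f k) :=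
  Finset.le_sum_of_subadditive _ hammingNorm_zero.le hammingNorm_add_le t f

/-- Combining the columns `∑ j, A j k • c j` of a matrix-product codeword with the entries of the
`i`-th column of a right inverse of `A` gives back `c i`. -/
theorem Matrix.sum_smul_sum_smul_of_mul_eq_one {R M ι κ : Type*} [CommSemiring R]
    [AddCommMonoid M] [Module R M] [Fintype ι] [DecidableEq ι] [Fintype κ]
    {A : Matrix ι κ R} {B : Matrix κ ι R} (hAB : A * B = 1) (c : ι → M) (i : ι) :
    ∑ k, B k i • ∑ j, A j k • c j = c i := by
  calc ∑ k, B k i • ∑ j, A j k • c j = ∑ j, (A * B) j i • c j := by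
        simp only [Finset.smul_sum, smul_smul, Matrix.mul_apply, Finset.sum_smul]
        rw [Finset.sum_comm]
        simp only [mul_comm]
    _ = c i := by simp [hAB, Matrix.one_apply]

/-- Correctness of the recovery of `c i` in the first extension of the decoding
algorithm for matrix-product codes: multiplying the received word by the `i`-th
column of a right inverse `B` of `A` yields `c i` plus an error of weight at most
`wt e`; if moreover `2 * wt e < d i`, then `c i` is the unique codeword of `C i`
within half the minimum distance. -/
theorem stmt8 {F : Type*} [Field F] [DecidableEq F] (m s l : ℕ)
    (hm : 0 < m) (hs : 0 < s) (hl : 0 < l) (hsl : s ≤ l)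
    (A : Matrix (Fin s) (Fin l) F) (B : Matrix (Fin l) (Fin s) F) (hAB : A * B = 1)
    (c : Fin s → (Fin m → F)) (e : Fin l → (Fin m → F))
    (r : Fin l → (Fin m → F)) (hr : ∀ k, r k = (∑ j, A j k • c j) + e k)
    (i : Fin s) (v : Fin l → F) (hv : ∀ k, v k = B k i) :
    hammingDist (∑ k, v k • r k) (c i) ≤ ∑ k, hammingNorm (e k) ∧
      ∀ (Ci : Submodule F (Fin m → F)) (di : ℕ), c i ∈ Ci →
        (∀ x ∈ Ci, x ≠ 0 → di ≤ hammingNorm x) →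
        2 * ∑ k, hammingNorm (e k) < di →
        (2 * hammingDist (∑ k, v k • r k) (c i) < di ∧
          ∀ x ∈ Ci, 2 * hammingDist (∑ k, v k • r k) x < di → x = c i) := by
  have hsum : ∑ k, v k • r k = c i + ∑ k, v k • e k := by
    simp only [hr, hv, smul_add, Finset.sum_add_distrib,
      Matrix.sum_smul_sum_smul_of_mul_eq_one hAB]
  have hdist : hammingDist (∑ k, v k • r k) (c i) ≤ ∑ k, hammingNorm (e k) := by
    calc hammingDist (∑ k, v k • r k) (c i) = hammingNorm (∑ k, v k • e k) := by
          rw [hsum, hammingDist_comm, hammingDist_eq_hammingNorm, neg_add_cancel_left]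
      _ ≤ ∑ k, hammingNorm (v k • e k) := hammingNorm_sum_le _ _
      _ ≤ ∑ k, hammingNorm (e k) := Finset.sum_le_sum fun k _ => hammingNorm_smul_le_hammingNorm
  refine ⟨hdist, fun Ci di hci hmin hlt => ⟨by lia, fun x hx hxlt => ?_⟩⟩
  by_contra hne
  have hle := hmin (x - c i) (Ci.sub_mem hx hci) (sub_ne_zero.mpr hne)
  have hnorm : hammingNorm (x - c i) = hammingDist x (c i) := by
    rw [hammingDist_comm, hammingDist_eq_hammingNorm, neg_add_eq_sub]
  have htri := hammingDist_triangle_left x (c i) (∑ k, v k • r k)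
  lia
end

section
/- Let F be a field, m a positive integer, t_1 ≥ 1 an integer, and d_1 = 2·t_1 + 1. Let u ∈ F^m with wt(u) ≥ d_1, and let e_1, e_2 ∈ F^m with wt(e_1) + wt(e_2) ≤ 2·t_1 + 1. Then wt(u + e_1) + wt(u + e_2) = 2·t_1 + 1 if and only if the following three conditions hold: wt(u) = d_1; wt(e_1) + wt(e_2) = 2·t_1 + 1; and for each i ∈ {1, 2} and each coordinate j ∈ {1, …, m} with (e_i)_j ≠ 0 one has (e_i)_j = −u_j. -/
section HammingNorm

variable {ι : Type*} [Fintype ι] {β : ι → Type*} [∀ i, DecidableEq (β i)]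

theorem hammingNorm_eq_sum [∀ i, Zero (β i)] (x : ∀ i, β i) :
    hammingNorm x = ∑ i, if x i ≠ 0 then 1 else 0 :=
  Finset.card_filter _ _

variable [∀ i, AddGroup (β i)]

theorem ite_ne_zero_le_add {G : Type*} [AddGroup G] [DecidableEq G] (a b : G) :
    (if a ≠ 0 then 1 else 0) ≤ (if a + b ≠ 0 then 1 else 0) + (if b ≠ 0 then 1 else 0) := by
  by_cases hb : b = 0 <;> by_cases ha : a = 0 <;> simp [ha, hb]

theorem ite_ne_zero_eq_add_iff {G : Type*} [AddGroup G] [DecidableEq G] (a b : G) :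
    (if a ≠ 0 then 1 else 0) = (if a + b ≠ 0 then 1 else 0) + (if b ≠ 0 then 1 else 0) ↔
      (b ≠ 0 → b = -a) := by
  by_cases hb : b = 0
  · simp [hb]
  · by_cases ha : a = 0
    · simp [ha, hb]
    · simp [ha, hb, add_eq_zero_iff_neg_eq, eq_comm]

theorem hammingNorm_le_hammingNorm_add_add (x y : ∀ i, β i) :
    hammingNorm x ≤ hammingNorm (x + y) + hammingNorm y := by
  simp only [hammingNorm_eq_sum, Pi.add_apply, ← Finset.sum_add_distrib]
  exact Finset.sum_le_sum fun i _ => ite_ne_zero_le_add (x i) (y i)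

/-- The triangle inequality `wt x ≤ wt (x + y) + wt y` is an equality exactly when `y` agrees
with `-x` on its support. -/
theorem hammingNorm_eq_hammingNorm_add_add_iff (x y : ∀ i, β i) :
    hammingNorm x = hammingNorm (x + y) + hammingNorm y ↔ ∀ i, y i ≠ 0 → y i = -x i := by
  simp only [hammingNorm_eq_sum, Pi.add_apply, ← Finset.sum_add_distrib]
  rw [Finset.sum_eq_sum_iff_of_le fun i _ => ite_ne_zero_le_add (x i) (y i)]
  simp only [Finset.mem_univ, true_imp_iff, ite_ne_zero_eq_add_iff]

end HammingNorm

/-- The equality characterization from Section 3: with `d₁ = 2 t₁ + 1`, `wt u ≥ d₁`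
and `wt e₁ + wt e₂ ≤ 2 t₁ + 1`, one has `wt(u + e₁) + wt(u + e₂) = 2 t₁ + 1` exactly
when `wt u = d₁`, `wt e₁ + wt e₂ = 2 t₁ + 1` and every nonzero coordinate of `e₁`
or `e₂` equals the negative of the corresponding coordinate of `u`. -/
theorem stmt12 {F : Type*} [Field F] [DecidableEq F] (m : ℕ) (hm : 0 < m)
    (t₁ : ℕ) (ht₁ : 1 ≤ t₁) (d₁ : ℕ) (hd₁ : d₁ = 2 * t₁ + 1)
    (u : Fin m → F) (hu : d₁ ≤ hammingNorm u)
    (e₁ e₂ : Fin m → F) (he : hammingNorm e₁ + hammingNorm e₂ ≤ 2 * t₁ + 1) :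
    hammingNorm (u + e₁) + hammingNorm (u + e₂) = 2 * t₁ + 1 ↔
      (hammingNorm u = d₁ ∧ hammingNorm e₁ + hammingNorm e₂ = 2 * t₁ + 1 ∧
        ∀ j : Fin m, (e₁ j ≠ 0 → e₁ j = -u j) ∧ (e₂ j ≠ 0 → e₂ j = -u j)) := by
  have h₁ := hammingNorm_le_hammingNorm_add_add u e₁
  have h₂ := hammingNorm_le_hammingNorm_add_add u e₂
  rw [forall_and, ← hammingNorm_eq_hammingNorm_add_add_iff,
    ← hammingNorm_eq_hammingNorm_add_add_iff]
  omega
end
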